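/- arXiv:2305.11642 — 2 statements merged into one kernel-verified Lean document; each statement's English description precedes it below -/
import Mathlib

section
/- Let CNOT be the 4×4 unitary matrix [[1,0,0,0],[0,1,0,0],[0,0,0,1],[0,0,1,0]]. Then for every 4×4 complex matrix ρ: CNOT ρ CNOT† = −(1/2)[I⊗R_X]ρ + (1/2)[I⊗X]ρ + [I⊗π_X]ρ − (1/2)[R_Z⊗I]ρ + [R_Z⊗R_X]ρ − (1/2)[R_Z⊗X]ρ + (1/2)[Z⊗I]ρ − (1/2)[Z⊗R_X]ρ + [Z⊗X]ρ − [Z⊗π_X]ρ + [π_Z⊗I]ρ − [π_Z⊗X]ρ, where R_X=(I+iX)/√2, R_Z=(I+iZ)/√2, π_X=(I+X)/2, π_Z=(I+Z)/2. Moreover, the sum of the absolute values of the twelve coefficients equals 9. -/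
open Matrix
open scoped Matrix Kronecker

noncomputable section

/-- Kronecker product of square complex matrices, with the standard lexicographic
identification `Fin m × Fin n ≃ Fin (m * n)` (left factor most significant). -/
def kron {m n : ℕ} (A : Matrix (Fin m) (Fin m) ℂ) (B : Matrix (Fin n) (Fin n) ℂ) :
    Matrix (Fin (m * n)) (Fin (m * n)) ℂ :=
  Matrix.reindex finProdFinEquiv finProdFinEquiv (A ⊗ₖ B)

/-- Transport a square matrix along an equality of dimensions. -/
def castM {a b : ℕ} (h : a = b) (A : Matrix (Fin a) (Fin a) ℂ) : Matrix (Fin b) (Fin b) ℂ :=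
  Matrix.reindex (finCongr h) (finCongr h) A

theorem pow2mul {a b c : ℕ} (h : a + b = c) : 2 ^ a * 2 ^ b = 2 ^ c := by
  rw [← pow_add, h]

def ket0bra0 : Matrix (Fin 2) (Fin 2) ℂ := !![1, 0; 0, 0]
def ket1bra1 : Matrix (Fin 2) (Fin 2) ℂ := !![0, 0; 0, 1]
def PauliX : Matrix (Fin 2) (Fin 2) ℂ := !![0, 1; 1, 0]
def PauliY : Matrix (Fin 2) (Fin 2) ℂ := !![0, -Complex.I; Complex.I, 0]
def PauliZ : Matrix (Fin 2) (Fin 2) ℂ := !![1, 0; 0, -1]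

/-- `n`-fold Kronecker product of one-qubit matrices, `f 0` being the leftmost factor. -/
def kronPow : (k : ℕ) → (Fin k → Matrix (Fin 2) (Fin 2) ℂ) →
    Matrix (Fin (2 ^ k)) (Fin (2 ^ k)) ℂ
  | 0, _ => 1
  | k + 1, f => castM (pow2mul (Nat.one_add k)) (kron (f 0) (kronPow k fun i => f i.succ))

/-- `(|0⟩⟨0|)^{⊗ k}`. -/
def projPow (k : ℕ) : Matrix (Fin (2 ^ k)) (Fin (2 ^ k)) ℂ := kronPow k fun _ => ket0bra0

/-- Diagonal projection with the first `r` diagonal entries equal to 1. -/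
def diagProj (N r : ℕ) : Matrix (Fin N) (Fin N) ℂ :=
  Matrix.diagonal fun i => if (i : ℕ) < r then 1 else 0

/-- The sixteen Table-1 basis matrices (0-indexed). -/
def tableV : Fin 16 → Matrix (Fin 2) (Fin 2) ℂ :=
  ![1, PauliX, PauliY, PauliZ,
    ((Real.sqrt 2 : ℝ) : ℂ)⁻¹ • (1 + Complex.I • PauliX),
    ((Real.sqrt 2 : ℝ) : ℂ)⁻¹ • (1 + Complex.I • PauliY),
    ((Real.sqrt 2 : ℝ) : ℂ)⁻¹ • (1 + Complex.I • PauliZ),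
    ((Real.sqrt 2 : ℝ) : ℂ)⁻¹ • (PauliY + PauliZ),
    ((Real.sqrt 2 : ℝ) : ℂ)⁻¹ • (PauliZ + PauliX),
    ((Real.sqrt 2 : ℝ) : ℂ)⁻¹ • (PauliX + PauliY),
    (2 : ℂ)⁻¹ • (1 + PauliX),
    (2 : ℂ)⁻¹ • (1 + PauliY),
    (2 : ℂ)⁻¹ • (1 + PauliZ),
    (2 : ℂ)⁻¹ • (PauliY + Complex.I • PauliZ),
    (2 : ℂ)⁻¹ • (PauliZ + Complex.I • PauliX),
    (2 : ℂ)⁻¹ • (PauliX + Complex.I • PauliY)]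


def CNOT : Matrix (Fin 4) (Fin 4) ℂ :=
  !![1,0,0,0; 0,1,0,0; 0,0,0,1; 0,0,1,0]

def RX : Matrix (Fin 2) (Fin 2) ℂ := ((Real.sqrt 2 : ℝ) : ℂ)⁻¹ • (1 + Complex.I • PauliX)
def RZ : Matrix (Fin 2) (Fin 2) ℂ := ((Real.sqrt 2 : ℝ) : ℂ)⁻¹ • (1 + Complex.I • PauliZ)
def piX : Matrix (Fin 2) (Fin 2) ℂ := (2 : ℂ)⁻¹ • (1 + PauliX)
def piZ : Matrix (Fin 2) (Fin 2) ℂ := (2 : ℂ)⁻¹ • (1 + PauliZ)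

/-- Two-qubit Kronecker product, as a `4 × 4` matrix. -/
def kron2 (A B : Matrix (Fin 2) (Fin 2) ℂ) : Matrix (Fin 4) (Fin 4) ℂ := kron A B

theorem kron2_eq_reindex (A B : Matrix (Fin 2) (Fin 2) ℂ) :
    kron2 A B = Matrix.reindexAlgEquiv ℂ ℂ (finProdFinEquiv (m := 2) (n := 2)) (A ⊗ₖ B) :=
  rfl

theorem kron2_one_one : kron2 1 1 = 1 := by
  rw [kron2_eq_reindex, Matrix.one_kronecker_one, map_one]

theorem kron2_mul_kron2 (A B C D : Matrix (Fin 2) (Fin 2) ℂ) :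
    kron2 A B * kron2 C D = kron2 (A * C) (B * D) := by
  simp only [kron2_eq_reindex, Matrix.mul_kronecker_mul]
  exact (map_mul (Matrix.reindexAlgEquiv ℂ ℂ (finProdFinEquiv (m := 2) (n := 2))) _ _).symm

theorem conjTranspose_kron2 (A B : Matrix (Fin 2) (Fin 2) ℂ) :
    (kron2 A B)ᴴ = kron2 Aᴴ Bᴴ := by
  simp only [kron2, kron, Matrix.conjTranspose_reindex, Matrix.conjTranspose_kronecker]

theorem kron2_eq_mul (A B : Matrix (Fin 2) (Fin 2) ℂ) :
    kron2 A B = kron2 A 1 * kron2 1 B := by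
  rw [kron2_mul_kron2, mul_one, one_mul]

theorem kron2_one_affine (a b : ℂ) (B : Matrix (Fin 2) (Fin 2) ℂ) :
    kron2 1 (a • (1 + b • B)) = a • (1 + b • kron2 1 B) := by
  rw [← kron2_one_one]
  simp only [kron2_eq_reindex, Matrix.kronecker_smul, Matrix.kronecker_add, map_smul, map_add]

theorem kron2_affine_one (a b : ℂ) (A : Matrix (Fin 2) (Fin 2) ℂ) :
    kron2 (a • (1 + b • A)) 1 = a • (1 + b • kron2 A 1) := by
  rw [← kron2_one_one]
  simp only [kron2_eq_reindex, Matrix.smul_kronecker, Matrix.add_kronecker, map_smul, map_add]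

theorem conjTranspose_PauliX : PauliXᴴ = PauliX := by
  ext i j
  fin_cases i <;> fin_cases j <;> simp [PauliX]

theorem conjTranspose_PauliZ : PauliZᴴ = PauliZ := by
  ext i j
  fin_cases i <;> fin_cases j <;> simp [PauliZ]

theorem CNOT_eq :
    CNOT = (1 / 2 : ℂ) •
      (1 + kron2 PauliZ 1 + kron2 1 PauliX - kron2 PauliZ 1 * kron2 1 PauliX) := by
  rw [kron2_mul_kron2, mul_one, one_mul, ← kron2_one_one]
  ext i j
  fin_cases i <;> fin_cases j <;>
    simp [CNOT, kron2, kron, PauliX, PauliZ, finProdFinEquiv, Fin.divNat, Fin.modNat] <;> norm_num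

theorem inv_sqrt_two_mul_self :
    ((Real.sqrt 2 : ℝ) : ℂ)⁻¹ * ((Real.sqrt 2 : ℝ) : ℂ)⁻¹ = 1 / 2 := by
  rw [← mul_inv, ← Complex.ofReal_mul, Real.mul_self_sqrt (by norm_num)]
  norm_num

/-- the gate decomposition of CNOT, with sampling overhead 9. -/
theorem stmt9 :
    (∀ ρ : Matrix (Fin 4) (Fin 4) ℂ,
      CNOT * ρ * CNOTᴴ =
        -(1/2 : ℂ) • (kron2 1 RX * ρ * (kron2 1 RX)ᴴ)
        + (1/2 : ℂ) • (kron2 1 PauliX * ρ * (kron2 1 PauliX)ᴴ)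
        + (kron2 1 piX * ρ * (kron2 1 piX)ᴴ)
        - (1/2 : ℂ) • (kron2 RZ 1 * ρ * (kron2 RZ 1)ᴴ)
        + (kron2 RZ RX * ρ * (kron2 RZ RX)ᴴ)
        - (1/2 : ℂ) • (kron2 RZ PauliX * ρ * (kron2 RZ PauliX)ᴴ)
        + (1/2 : ℂ) • (kron2 PauliZ 1 * ρ * (kron2 PauliZ 1)ᴴ)
        - (1/2 : ℂ) • (kron2 PauliZ RX * ρ * (kron2 PauliZ RX)ᴴ)
        + (kron2 PauliZ PauliX * ρ * (kron2 PauliZ PauliX)ᴴ)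
        - (kron2 PauliZ piX * ρ * (kron2 PauliZ piX)ᴴ)
        + (kron2 piZ 1 * ρ * (kron2 piZ 1)ᴴ)
        - (kron2 piZ PauliX * ρ * (kron2 piZ PauliX)ᴴ))
    ∧ |(-(1/2) : ℝ)| + |(1/2 : ℝ)| + |(1 : ℝ)| + |(-(1/2) : ℝ)| + |(1 : ℝ)| + |(-(1/2) : ℝ)|
        + |(1/2 : ℝ)| + |(-(1/2) : ℝ)| + |(1 : ℝ)| + |(-1 : ℝ)| + |(1 : ℝ)| + |(-1 : ℝ)| = 9 := by
  refine ⟨fun ρ => ?_, by norm_num⟩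
  have hs := inv_sqrt_two_mul_self
  have hc : star ((Real.sqrt 2 : ℝ) : ℂ)⁻¹ = ((Real.sqrt 2 : ℝ) : ℂ)⁻¹ := by
    rw [← Complex.ofReal_inv]
    exact Complex.conj_ofReal _
  have hI : star Complex.I = -Complex.I := Complex.conj_I
  have hI_sq := Complex.I_mul_I
  have hX : (kron2 1 PauliX)ᴴ = kron2 1 PauliX := by
    rw [conjTranspose_kron2, Matrix.conjTranspose_one, conjTranspose_PauliX]
  have hZ : (kron2 PauliZ 1)ᴴ = kron2 PauliZ 1 := by
    rw [conjTranspose_kron2, Matrix.conjTranspose_one, conjTranspose_PauliZ]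
  have hcomm : kron2 1 PauliX * kron2 PauliZ 1 = kron2 PauliZ 1 * kron2 1 PauliX := by
    simp only [kron2_mul_kron2, mul_one, one_mul]
  have hpiX : piX = (2 : ℂ)⁻¹ • (1 + (1 : ℂ) • PauliX) := by rw [one_smul, piX]
  have hpiZ : piZ = (2 : ℂ)⁻¹ • (1 + (1 : ℂ) • PauliZ) := by rw [one_smul, piZ]
  rw [kron2_eq_mul RZ RX, kron2_eq_mul RZ PauliX, kron2_eq_mul PauliZ RX,
    kron2_eq_mul PauliZ PauliX, kron2_eq_mul PauliZ piX, kron2_eq_mul piZ PauliX, CNOT_eq,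
    RX, RZ, hpiX, hpiZ]
  simp only [kron2_one_affine, kron2_affine_one]
  generalize ((Real.sqrt 2 : ℝ) : ℂ)⁻¹ = s at hs hc ⊢
  generalize kron2 1 PauliX = x at hX hcomm ⊢
  generalize kron2 PauliZ 1 = z at hZ hcomm ⊢
  simp only [Matrix.conjTranspose_mul, Matrix.conjTranspose_smul, Matrix.conjTranspose_add,
    Matrix.conjTranspose_sub, Matrix.conjTranspose_one, hX, hZ, hc, hI, star_one, star_inv₀,
    star_div₀, star_ofNat, mul_assoc, mul_add, add_mul, mul_sub, sub_mul, smul_mul_assoc,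
    mul_smul_comm, mul_one, one_mul, hcomm]
  match_scalars <;> grind

end
end

section
/- Let n ≥ 1, N = 2^n, U an N×N complex unitary matrix, P_in and P_out N×N Hermitian idempotent matrices of ranks r_in ≥ 1 and r_out ≥ 1, and O_in, O_out N×N unitaries with P_in = O_in† · diag(I_{r_in}, 0) · O_in and P_out = O_out · diag(I_{r_out}, 0) · O_out†. Set ñ = ⌈log₂ max(r_in, r_out)⌉. Then there exist real numbers c, indexed by functions i : Fin ñ → Fin 16, such that for every N×N complex matrix ρ: (P_out · U · P_in) ρ (P_out · U · P_in)† = Σ_i c_i · W_i ρ W_i†, where W_i = O_out · ((|0⟩⟨0|)^{⊗(n-ñ)} ⊗ V_{i(1)} ⊗ ⋯ ⊗ V_{i(ñ)}) · O_in and V₁, …, V₁₆ are the Table-1 basis matrices. (Theorem 2 of the paper.) -/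
open Matrix
open scoped Matrix Kronecker

noncomputable section

/-- The Pauli basis of the one-qubit matrices. -/
def pauli : Fin 4 → Matrix (Fin 2) (Fin 2) ℂ := ![1, PauliX, PauliY, PauliZ]

lemma exists_eq_sum_pauli (F : Fin 2 → Fin 2 → ℂ) :
    ∃ t : Fin 4 → ℂ, ∀ i j, F i j = ∑ a, t a * pauli a i j := by
  refine ⟨![(F 0 0 + F 1 1) / 2, (F 0 1 + F 1 0) / 2, Complex.I * (F 0 1 - F 1 0) / 2,
    (F 0 0 - F 1 1) / 2], fun i j => ?_⟩
  fin_cases i <;> fin_cases j <;>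
    simp [Fin.sum_univ_four, pauli, PauliX, PauliY, PauliZ] <;> ring_nf <;>
    simp only [Complex.I_sq] <;> ring

lemma exists_eq_sum_star_pauli (F : Fin 2 → Fin 2 → ℂ) :
    ∃ t : Fin 4 → ℂ, ∀ i j, F i j = ∑ a, t a * star (pauli a i j) := by
  obtain ⟨t, ht⟩ := exists_eq_sum_pauli fun i j => star (F i j)
  refine ⟨fun a => star (t a), fun i j => ?_⟩
  rw [← star_star (F i j), ht i j, star_sum]
  simp

lemma exists_eq_sum_pauli_mul_star_pauli (T : Fin 2 → Fin 2 → Fin 2 → Fin 2 → ℂ) :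
    ∃ t : Fin 4 → Fin 4 → ℂ, ∀ i j k l,
      T i j k l = ∑ a, ∑ b, t a b * (pauli a i j * star (pauli b k l)) := by
  choose s hs using fun k l => exists_eq_sum_pauli fun i j => T i j k l
  choose t ht using fun a => exists_eq_sum_star_pauli fun k l => s k l a
  refine ⟨t, fun i j k l => ?_⟩
  rw [hs k l i j]
  refine Finset.sum_congr rfl fun a _ => ?_
  rw [ht a k l, Finset.sum_mul]
  exact Finset.sum_congr rfl fun b _ => by ring

/-- Polarization: `ρ ↦ P_a ρ P_bᴴ` is a combination of the maps `ρ ↦ V ρ Vᴴ`, `V` in the table. -/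
lemma exists_sum_pauli_eq_sum_tableV (t : Fin 4 → Fin 4 → ℂ) :
    ∃ c : Fin 16 → ℂ, ∀ i j k l,
      ∑ a, ∑ b, t a b * (pauli a i j * star (pauli b k l))
        = ∑ f, c f * (tableV f i j * star (tableV f k l)) := by
  set s : Fin 4 → Fin 4 → ℂ := fun a b => (t a b + t b a) / 2 with hs
  set d : Fin 4 → Fin 4 → ℂ := fun a b => Complex.I * (t a b - t b a) / 2 with hd
  refine ⟨![t 0 0 - (s 0 1 + d 0 1 + s 0 2 + d 0 2 + s 0 3 + d 0 3),
    t 1 1 - (s 0 1 + d 0 1 + s 3 1 + d 3 1 + s 1 2 + d 1 2),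
    t 2 2 - (s 0 2 + d 0 2 + s 2 3 + d 2 3 + s 1 2 + d 1 2),
    t 3 3 - (s 0 3 + d 0 3 + s 2 3 + d 2 3 + s 3 1 + d 3 1),
    2 * d 0 1, 2 * d 0 2, 2 * d 0 3, 2 * s 2 3, 2 * s 3 1, 2 * s 1 2,
    4 * s 0 1, 4 * s 0 2, 4 * s 0 3, 4 * d 2 3, 4 * d 3 1, 4 * d 1 2], fun i j k l => ?_⟩
  have hu : (((Real.sqrt 2 : ℝ) : ℂ)⁻¹) ^ 2 = 1 / 2 := by
    rw [inv_pow, ← Complex.ofReal_pow, Real.sq_sqrt zero_le_two]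
    norm_num
  simp only [Fin.sum_univ_four, pauli, Matrix.cons_val]
  simp only [Fin.sum_univ_succ, Fin.sum_univ_zero, tableV, Matrix.cons_val_zero,
    Matrix.cons_val_succ, Matrix.smul_apply, Matrix.add_apply, smul_eq_mul, Complex.star_def,
    map_mul, map_add, map_inv₀, Complex.conj_ofReal, Complex.conj_I, map_ofNat, hs, hd]
  generalize (((Real.sqrt 2 : ℝ) : ℂ)⁻¹) = u at hu ⊢
  generalize (1 : Matrix (Fin 2) (Fin 2) ℂ) i j = p₀
  generalize (starRingEnd ℂ) ((1 : Matrix (Fin 2) (Fin 2) ℂ) k l) = q₀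
  generalize PauliX i j = p₁
  generalize PauliY i j = p₂
  generalize PauliZ i j = p₃
  generalize (starRingEnd ℂ) (PauliX k l) = q₁
  generalize (starRingEnd ℂ) (PauliY k l) = q₂
  generalize (starRingEnd ℂ) (PauliZ k l) = q₃
  have h3 : Complex.I ^ 3 = -Complex.I := by rw [pow_succ, Complex.I_sq]; ring
  ring_nf
  simp only [hu, Complex.I_sq, h3]
  ring

lemma exists_eq_sum_tableV (T : Fin 2 → Fin 2 → Fin 2 → Fin 2 → ℂ) :
    ∃ c : Fin 16 → ℂ, ∀ i j k l,
      T i j k l = ∑ f, c f * (tableV f i j * star (tableV f k l)) := by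
  obtain ⟨t, ht⟩ := exists_eq_sum_pauli_mul_star_pauli T
  obtain ⟨c, hc⟩ := exists_sum_pauli_eq_sum_tableV t
  exact ⟨c, fun i j k l => (ht i j k l).trans (hc i j k l)⟩

/-- Splits off the most significant qubit of a basis index. -/
def qubitSplit (k : ℕ) : Fin (2 ^ (k + 1)) ≃ Fin 2 × Fin (2 ^ k) :=
  (finCongr (pow2mul (Nat.one_add k))).symm.trans finProdFinEquiv.symm

lemma kronPow_succ_apply (k : ℕ) (f : Fin (k + 1) → Matrix (Fin 2) (Fin 2) ℂ)
    (i j : Fin (2 ^ (k + 1))) :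
    kronPow (k + 1) f i j
      = f 0 (qubitSplit k i).1 (qubitSplit k j).1
        * kronPow k (fun m => f m.succ) (qubitSplit k i).2 (qubitSplit k j).2 := rfl

lemma val_eq_qubitSplit (k : ℕ) (i : Fin (2 ^ (k + 1))) :
    (i : ℕ) = (qubitSplit k i).2 + 2 ^ k * (qubitSplit k i).1 := by
  have h := (qubitSplit k).symm_apply_apply i
  conv_lhs => rw [← h]
  rfl

lemma projPow_apply (k : ℕ) (i j : Fin (2 ^ k)) :
    projPow k i j = if (i : ℕ) = 0 ∧ (j : ℕ) = 0 then 1 else 0 := by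
  induction k with
  | zero =>
    have hi : (i : ℕ) = 0 := by omega
    have hj : (j : ℕ) = 0 := by omega
    obtain rfl : i = j := Fin.ext (hi.trans hj.symm)
    rw [if_pos ⟨hi, hj⟩]
    exact Matrix.one_apply_eq i
  | succ k ih =>
    have h : projPow (k + 1) i j = ket0bra0 (qubitSplit k i).1 (qubitSplit k j).1
        * projPow k (qubitSplit k i).2 (qubitSplit k j).2 := kronPow_succ_apply k _ i j
    rw [h, ih, val_eq_qubitSplit k i, val_eq_qubitSplit k j]
    generalize (qubitSplit k i).1 = a, (qubitSplit k j).1 = b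
    fin_cases a <;> fin_cases b <;> simp [ket0bra0]

lemma exists_eq_sum_kronPow_tableV (k : ℕ)
    (T : Fin (2 ^ k) → Fin (2 ^ k) → Fin (2 ^ k) → Fin (2 ^ k) → ℂ) :
    ∃ c : (Fin k → Fin 16) → ℂ, ∀ i j x y,
      T i j x y = ∑ f, c f * (kronPow k (fun m => tableV (f m)) i j
        * star (kronPow k (fun m => tableV (f m)) x y)) := by
  induction k with
  | zero =>
    refine ⟨fun _ => T 0 0 0 0, fun i j x y => ?_⟩
    have h0 (z : Fin (2 ^ 0)) : z = 0 := Subsingleton.elim (α := Fin 1) z 0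
    rw [h0 i, h0 j, h0 x, h0 y]
    simp [kronPow]
  | succ k ih =>
    let e := qubitSplit k
    choose c hc using fun i j x y => exists_eq_sum_tableV fun a b p q =>
      T (e.symm (a, i)) (e.symm (b, j)) (e.symm (p, x)) (e.symm (q, y))
    choose c' hc' using fun g => ih fun i j x y => c i j x y g
    refine ⟨fun f => c' (f 0) fun m => f m.succ, fun i j x y => ?_⟩
    have h := hc (e i).2 (e j).2 (e x).2 (e y).2 (e i).1 (e j).1 (e x).1 (e y).1
    simp only [Prod.mk.eta, Equiv.symm_apply_apply] at h
    rw [h, ← (Fin.consEquiv fun _ : Fin (k + 1) => Fin 16).sum_comp, Fintype.sum_prod_type]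
    refine Finset.sum_congr rfl fun g _ => ?_
    rw [hc' g, Finset.sum_mul]
    refine Finset.sum_congr rfl fun f _ => ?_
    simp only [kronPow_succ_apply, Fin.consEquiv_apply, Fin.cons_zero, Fin.cons_succ, star_mul', e]
    ring

/-- A Hermiticity-preserving map is a real combination of the maps `ρ ↦ V ρ Vᴴ`. -/
lemma exists_mul_star_eq_real_sum_kronPow_tableV (k : ℕ)
    (A : Matrix (Fin (2 ^ k)) (Fin (2 ^ k)) ℂ) :
    ∃ c : (Fin k → Fin 16) → ℝ, ∀ i j x y,
      A i j * star (A x y) = ∑ f, (c f : ℂ) * (kronPow k (fun m => tableV (f m)) i j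
        * star (kronPow k (fun m => tableV (f m)) x y)) := by
  obtain ⟨c, hc⟩ := exists_eq_sum_kronPow_tableV k fun i j x y => A i j * star (A x y)
  refine ⟨fun f => (c f).re, fun i j x y => ?_⟩
  have h := congrArg star (hc x y i j)
  simp only [star_sum, star_mul', star_star] at h
  have h₂ : A i j * star (A x y) = (A i j * star (A x y) + star (A x y) * A i j) / 2 := by ring
  rw [h₂, h, hc i j x y, ← Finset.sum_add_distrib, Finset.sum_div]
  refine Finset.sum_congr rfl fun f _ => ?_
  rw [Complex.re_eq_add_conj, Complex.star_def]
  ring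

lemma conj_mul_eq_sum_of_entries {N : ℕ} {ι : Type*} [Fintype ι] (L M R : Matrix (Fin N) (Fin N) ℂ)
    (W : ι → Matrix (Fin N) (Fin N) ℂ) (c : ι → ℂ)
    (h : ∀ i j x y, M i j * star (M x y) = ∑ f, c f * (W f i j * star (W f x y)))
    (ρ : Matrix (Fin N) (Fin N) ℂ) :
    (L * M * R) * ρ * (L * M * R)ᴴ = ∑ f, c f • ((L * W f * R) * ρ * (L * W f * R)ᴴ) := by
  have key (σ : Matrix (Fin N) (Fin N) ℂ) : M * σ * Mᴴ = ∑ f, c f • (W f * σ * (W f)ᴴ) := by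
    ext i x
    simp only [Matrix.sum_apply, Matrix.smul_apply, Matrix.mul_apply, Matrix.conjTranspose_apply,
      smul_eq_mul, Finset.sum_mul, Finset.mul_sum]
    conv_rhs => rw [Finset.sum_comm]
    refine Finset.sum_congr rfl fun y _ => ?_
    conv_rhs => rw [Finset.sum_comm]
    refine Finset.sum_congr rfl fun j _ => ?_
    have := congrArg (σ j y * ·) (h i j x y)
    simp only [Finset.mul_sum] at this
    rw [show M i j * σ j y * star (M x y) = σ j y * (M i j * star (M x y)) by ring, this]
    exact Finset.sum_congr rfl fun f _ => by ring
  have hsplit (V : Matrix (Fin N) (Fin N) ℂ) :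
      (L * V * R) * ρ * (L * V * R)ᴴ = L * (V * (R * ρ * Rᴴ) * Vᴴ) * Lᴴ := by
    simp only [Matrix.conjTranspose_mul, Matrix.mul_assoc]
  simp only [hsplit, key, Matrix.mul_sum, Matrix.sum_mul, Matrix.mul_smul, Matrix.smul_mul]

lemma castM_kron_projPow_apply {m k n : ℕ} (h : 2 ^ m * 2 ^ k = 2 ^ n)
    (A : Matrix (Fin (2 ^ k)) (Fin (2 ^ k)) ℂ) (i j : Fin (2 ^ n)) :
    castM h (kron (projPow m) A) i j
      = if (i : ℕ) < 2 ^ k ∧ (j : ℕ) < 2 ^ k then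
          A ((finCongr h).symm i).modNat ((finCongr h).symm j).modNat else 0 := by
  have hij : castM h (kron (projPow m) A) i j
      = projPow m ((finCongr h).symm i).divNat ((finCongr h).symm j).divNat
        * A ((finCongr h).symm i).modNat ((finCongr h).symm j).modNat := rfl
  rw [hij, projPow_apply]
  simp [Nat.div_eq_zero_iff]

/-- A matrix supported on its leading `2 ^ k × 2 ^ k` block is `(|0⟩⟨0|)^{⊗ m} ⊗ A`. -/
lemma exists_eq_castM_kron_projPow {m k n : ℕ} (h : 2 ^ m * 2 ^ k = 2 ^ n)
    (M : Matrix (Fin (2 ^ n)) (Fin (2 ^ n)) ℂ)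
    (hM : ∀ i j : Fin (2 ^ n), ¬ ((i : ℕ) < 2 ^ k ∧ (j : ℕ) < 2 ^ k) → M i j = 0) :
    ∃ A, M = castM h (kron (projPow m) A) := by
  have hle : 2 ^ k ≤ 2 ^ n := h ▸ Nat.le_mul_of_pos_left _ (by positivity)
  refine ⟨M.submatrix (Fin.castLE hle) (Fin.castLE hle), ?_⟩
  ext i j
  rw [castM_kron_projPow_apply]
  split_ifs with hij
  · rw [Matrix.submatrix_apply]
    congr 1 <;> ext <;> simp [Nat.mod_eq_of_lt, hij]
  · exact hM i j hij

/-- Theorem 2 of the paper. -/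
theorem stmt13 (n rin rout : ℕ) (hn : 1 ≤ n) (hrin : 1 ≤ rin) (hrout : 1 ≤ rout)
    (U Pin Pout Oin Oout : Matrix (Fin (2 ^ n)) (Fin (2 ^ n)) ℂ)
    (hU : U ∈ Matrix.unitaryGroup (Fin (2 ^ n)) ℂ)
    (hOin : Oin ∈ Matrix.unitaryGroup (Fin (2 ^ n)) ℂ)
    (hOout : Oout ∈ Matrix.unitaryGroup (Fin (2 ^ n)) ℂ)
    (hPinH : Pinᴴ = Pin) (hPinIdem : Pin * Pin = Pin) (hPinRank : Pin.rank = rin)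
    (hPoutH : Poutᴴ = Pout) (hPoutIdem : Pout * Pout = Pout) (hPoutRank : Pout.rank = rout)
    (hdin : Pin = Oinᴴ * diagProj (2 ^ n) rin * Oin)
    (hdout : Pout = Oout * diagProj (2 ^ n) rout * Ooutᴴ) :
    ∃ (hdim : 2 ^ (n - Nat.clog 2 (max rin rout)) * 2 ^ Nat.clog 2 (max rin rout) = 2 ^ n)
      (c : (Fin (Nat.clog 2 (max rin rout)) → Fin 16) → ℝ),
      ∀ ρ : Matrix (Fin (2 ^ n)) (Fin (2 ^ n)) ℂ,
        (Pout * U * Pin) * ρ * (Pout * U * Pin)ᴴ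
          = ∑ f : Fin (Nat.clog 2 (max rin rout)) → Fin 16,
              (c f : ℂ) •
                ((Oout * castM hdim (kron (projPow (n - Nat.clog 2 (max rin rout)))
                    (kronPow (Nat.clog 2 (max rin rout)) fun k => tableV (f k))) * Oin) * ρ *
                 (Oout * castM hdim (kron (projPow (n - Nat.clog 2 (max rin rout)))
                    (kronPow (Nat.clog 2 (max rin rout)) fun k => tableV (f k))) * Oin)ᴴ) := by
  set k := Nat.clog 2 (max rin rout)
  have hmax : max rin rout ≤ 2 ^ n := by
    refine max_le ?_ ?_
    · simpa [hPinRank] using Pin.rank_le_card_width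
    · simpa [hPoutRank] using Pout.rank_le_card_width
  have hdim : 2 ^ (n - k) * 2 ^ k = 2 ^ n :=
    pow2mul (Nat.sub_add_cancel (Nat.clog_le_of_le_pow hmax))
  have hr : max rin rout ≤ 2 ^ k := Nat.le_pow_clog one_lt_two _
  obtain ⟨A, hA⟩ := exists_eq_castM_kron_projPow hdim
    (diagProj (2 ^ n) rout * (Ooutᴴ * U * Oinᴴ) * diagProj (2 ^ n) rin) (by
      intro i j hij
      simp only [diagProj, Matrix.mul_diagonal, Matrix.diagonal_mul]
      split_ifs with h₁ h₂
      · exact absurd ⟨h₁.trans_le ((le_max_right _ _).trans hr),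
          h₂.trans_le ((le_max_left _ _).trans hr)⟩ hij
      all_goals simp)
  obtain ⟨c, hc⟩ := exists_mul_star_eq_real_sum_kronPow_tableV k A
  refine ⟨hdim, c, fun ρ => ?_⟩
  have hP : Pout * U * Pin = Oout * castM hdim (kron (projPow (n - k)) A) * Oin := by
    rw [← hA, hdin, hdout]
    simp only [Matrix.mul_assoc]
  rw [hP]
  refine conj_mul_eq_sum_of_entries Oout _ Oin _ _ (fun i j x y => ?_) ρ
  simp only [castM_kron_projPow_apply]
  split_ifs <;> simp
  simpa using hc _ _ _ _

end
end
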